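/- Let W be the explicit Latin square of order 8 and W_1 its explicit 15-element subset given in the context. Then for every Latin trade T in W satisfying R(T) ≤ 3, or C(T) ≤ 3, or E(T) ≤ 3, the trade T intersects W_1 (i.e., T ∩ W_1 ≠ ∅). -/

import Mathlib

/-- A Latin square of order `n`, represented as a function giving the entry in
row `i`, column `j`: every element occurs exactly once in each row and column. -/
def IsLatinSquare {n : ℕ} (L : Fin n → Fin n → Fin n) : Prop :=
  (∀ i, Function.Injective (L i)) ∧ (∀ j, Function.Injective fun i => L i j)

/-- The set of triples `(i, j; L i j)` of a square `L`. -/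
def entries {n : ℕ} (L : Fin n → Fin n → Fin n) : Finset (Fin n × Fin n × Fin n) :=
  Finset.univ.image fun p : Fin n × Fin n => (p.1, p.2, L p.1 p.2)

/-- `T` is a Latin trade in `L`: the (nonempty) set of entries of `L` in the positions
where `L` differs from some other Latin square `L'` of the same order. -/
def IsTrade {n : ℕ} (L : Fin n → Fin n → Fin n)
    (T : Finset (Fin n × Fin n × Fin n)) : Prop :=
  ∃ L' : Fin n → Fin n → Fin n, IsLatinSquare L' ∧ L' ≠ L ∧
    T = (Finset.univ.filter fun p : Fin n × Fin n => L p.1 p.2 ≠ L' p.1 p.2).image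
          fun p => (p.1, p.2, L p.1 p.2)

/-- `U` is a uniquely completable set for `L`: `U ⊆ L` and `L` is the only
Latin square of order `n` containing `U`. -/
def IsUC {n : ℕ} (L : Fin n → Fin n → Fin n)
    (U : Finset (Fin n × Fin n × Fin n)) : Prop :=
  U ⊆ entries L ∧
    ∀ L' : Fin n → Fin n → Fin n, IsLatinSquare L' → U ⊆ entries L' → L' = L

/-- `C` is a critical set of `L`: a uniquely completable set for `L`,
no proper subset of which is uniquely completable. -/
def IsCritical {n : ℕ} (L : Fin n → Fin n → Fin n)
    (C : Finset (Fin n × Fin n × Fin n)) : Prop :=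
  IsUC L C ∧ ∀ C' ⊂ C, ¬ IsUC L C'

/-- `scs n`: the smallest size of a critical set in any Latin square of order `n`. -/
noncomputable def scs (n : ℕ) : ℕ :=
  sInf {s | ∃ (L : Fin n → Fin n → Fin n) (C : Finset (Fin n × Fin n × Fin n)),
    IsLatinSquare L ∧ IsCritical L C ∧ C.card = s}

/-- `R(T)`: the number of distinct rows occurring in `T`. -/
def rowCount {n : ℕ} (T : Finset (Fin n × Fin n × Fin n)) : ℕ :=
  (T.image fun t => t.1).card

/-- `C(T)`: the number of distinct columns occurring in `T`. -/
def colCount {n : ℕ} (T : Finset (Fin n × Fin n × Fin n)) : ℕ :=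
  (T.image fun t => t.2.1).card

/-- `E(T)`: the number of distinct elements occurring in `T`. -/
def elemCount {n : ℕ} (T : Finset (Fin n × Fin n × Fin n)) : ℕ :=
  (T.image fun t => t.2.2).card

/-- The Latin square `W` (0-based encoding of the square with rows
(8,6,7,4,1,2,3,5), (7,3,2,8,5,4,1,6), (6,4,5,3,7,1,2,8), (2,5,3,1,8,6,4,7),
(5,8,1,2,6,3,7,4), (1,7,4,6,3,8,5,2), (3,2,8,5,4,7,6,1), (4,1,6,7,2,5,8,3)). -/
def W : Fin 8 → Fin 8 → Fin 8 :=
  ![![7, 5, 6, 3, 0, 1, 2, 4],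
    ![6, 2, 1, 7, 4, 3, 0, 5],
    ![5, 3, 4, 2, 6, 0, 1, 7],
    ![1, 4, 2, 0, 7, 5, 3, 6],
    ![4, 7, 0, 1, 5, 2, 6, 3],
    ![0, 6, 3, 5, 2, 7, 4, 1],
    ![2, 1, 7, 4, 3, 6, 5, 0],
    ![3, 0, 5, 6, 1, 4, 7, 2]]

/-- The 15-element set `W₁` (0-based encoding of {(1,1;8),(1,3;7),(2,2;3),(2,7;1),
(3,1;6),(3,4;3),(4,5;8),(5,4;2),(5,8;4),(6,7;5),(6,8;2),(7,5;4),(7,6;7),(8,2;1),(8,3;6)}). -/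
def W1 : Finset (Fin 8 × Fin 8 × Fin 8) :=
  {(0,0,7), (0,2,6), (1,1,2), (1,6,0), (2,0,5), (2,3,2), (3,4,7), (4,3,1),
   (4,7,3), (5,6,4), (5,7,1), (6,4,3), (6,5,6), (7,1,0), (7,2,5)}

/-- The entries of three distinguished rows in a common column. -/
abbrev ColumnTriple : Type := Fin 8 × Fin 8 × Fin 8

/-- Two columns clash if they repeat an entry in one of the three distinguished rows. -/
def clash (s t : ColumnTriple) : Bool :=
  s.1 == t.1 || s.2.1 == t.2.1 || s.2.2 == t.2.2

/-- The six rearrangements of a column of height three. -/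
def rearrangements : ColumnTriple → List ColumnTriple
  | (x, y, z) => [(x, y, z), (x, z, y), (y, x, z), (y, z, x), (z, x, y), (z, y, x)]

/-- Backtracking search over the columns in the list: the result is `true` when, for every
clash-free choice of candidates compatible with `used`, `same` holds and the choice is `orig`. -/
def forcesOriginal (orig : Fin 8 → ColumnTriple) (cand : Fin 8 → List ColumnTriple) :
    List (Fin 8) → List ColumnTriple → Bool → Bool
  | [], _, same => same
  | j :: js, used, same =>
    (cand j).all fun t =>
      used.any (clash t) || forcesOriginal orig cand js (t :: used) (same && t == orig j)

theorem forcesOriginal_sound {orig : Fin 8 → ColumnTriple} {cand : Fin 8 → List ColumnTriple}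
    {f : Fin 8 → ColumnTriple} (hcand : ∀ j, f j ∈ cand j)
    (hclash : ∀ j k, j ≠ k → clash (f j) (f k) = false) :
    ∀ (js : List (Fin 8)) (used : List ColumnTriple) (same : Bool), js.Nodup →
      (∀ j ∈ js, ∀ u ∈ used, clash (f j) u = false) →
      forcesOriginal orig cand js used same = true → same = true ∧ ∀ j ∈ js, f j = orig j := by
  intro js
  induction js with
  | nil => intro used same _ _ h; exact ⟨h, by simp⟩
  | cons j js ih =>
    intro used same hnd hused h
    rw [List.nodup_cons] at hnd
    rw [forcesOriginal, List.all_eq_true] at h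
    have hj := h (f j) (hcand j)
    have hno : used.any (clash (f j)) = false := by
      rw [List.any_eq_false]
      intro u hu
      simp [hused j (by simp) u hu]
    rw [hno, Bool.false_or] at hj
    obtain ⟨hsame, hjs⟩ := ih (f j :: used) _ hnd.2 (by
      intro k hk u hu
      rcases List.mem_cons.mp hu with rfl | hu
      · exact hclash k j (fun hkj => hnd.1 (hkj ▸ hk))
      · exact hused k (List.mem_cons_of_mem _ hk) u hu) hj
    rw [Bool.and_eq_true, beq_iff_eq] at hsame
    exact ⟨hsame.1, by simpa using ⟨hsame.2, hjs⟩⟩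

/-- The part of column `j` of a square lying in the rows `a`, `b`, `c`. -/
def columnTriple (M : Fin 8 → Fin 8 → Fin 8) (a b c j : Fin 8) : ColumnTriple :=
  (M a j, M b j, M c j)

/-- The rearrangements of column `j` of `M` in rows `a`, `b`, `c` that keep the cells
marked by `fixed`. -/
def candidates (M : Fin 8 → Fin 8 → Fin 8) (fixed : Fin 8 → Fin 8 → Bool) (a b c j : Fin 8) :
    List ColumnTriple :=
  (rearrangements (columnTriple M a b c j)).filter fun t =>
    (!fixed a j || t.1 == M a j) && (!fixed b j || t.2.1 == M b j) &&
      (!fixed c j || t.2.2 == M c j)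

/-- No trade of `M` that is confined to three rows avoids all the cells marked by `fixed`,
as verified by search. -/
def RigidOnThreeRows (M : Fin 8 → Fin 8 → Fin 8) (fixed : Fin 8 → Fin 8 → Bool) : Prop :=
  ∀ a b c : Fin 8, a < b → b < c →
    forcesOriginal (columnTriple M a b c) (candidates M fixed a b c) (List.finRange 8) [] true
      = true

theorem mem_rearrangements {x y z x' y' z' : Fin 8} (hx : x' = x ∨ x' = y ∨ x' = z)
    (hy : y' = x ∨ y' = y ∨ y' = z) (hz : z' = x ∨ z' = y ∨ z' = z)
    (hxy : x' ≠ y') (hxz : x' ≠ z') (hyz : y' ≠ z') :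
    (x', y', z') ∈ rearrangements (x, y, z) := by
  rcases hx with rfl | rfl | rfl <;> rcases hy with rfl | rfl | rfl <;>
    rcases hz with rfl | rfl | rfl <;> simp_all [rearrangements]

/-- A Latin square agreeing with a rigid square outside three rows and on the fixed cells
agrees with it everywhere. -/
theorem RigidOnThreeRows.eq {M M' : Fin 8 → Fin 8 → Fin 8} {fixed : Fin 8 → Fin 8 → Bool}
    (hrigid : RigidOnThreeRows M fixed) (hM : IsLatinSquare M) (hM' : IsLatinSquare M')
    (hfixed : ∀ i j, fixed i j = true → M' i j = M i j)
    {S : Finset (Fin 8)} (hcard : S.card ≤ 3) (hS : ∀ i j, M i j ≠ M' i j → i ∈ S) :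
    M' = M := by
  obtain ⟨R, hSR, hR⟩ := Finset.exists_superset_card_eq hcard (by simp)
  have hab : R.orderEmbOfFin hR 0 < R.orderEmbOfFin hR 1 := by simp
  have hbc : R.orderEmbOfFin hR 1 < R.orderEmbOfFin hR 2 := by simp
  have hmem : ∀ i ∈ R, i = R.orderEmbOfFin hR 0 ∨ i = R.orderEmbOfFin hR 1 ∨
      i = R.orderEmbOfFin hR 2 := by
    intro i hi
    rw [← Finset.mem_coe, ← Finset.range_orderEmbOfFin R hR] at hi
    obtain ⟨k, rfl⟩ := hi
    fin_cases k <;> simp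
  generalize R.orderEmbOfFin hR 0 = a at *
  generalize R.orderEmbOfFin hR 1 = b at *
  generalize R.orderEmbOfFin hR 2 = c at *
  have houtside : ∀ i, i ≠ a → i ≠ b → i ≠ c → ∀ j, M' i j = M i j := by
    intro i ha hb hc j
    by_contra hne
    rcases hmem i (hSR (hS i j (Ne.symm hne))) with h | h | h <;> contradiction
  have hentry : ∀ r, (r = a ∨ r = b ∨ r = c) → ∀ j,
      M' r j = M a j ∨ M' r j = M b j ∨ M' r j = M c j := by
    intro r hr j
    obtain ⟨i, hi⟩ := (Finite.injective_iff_surjective.mp (hM.2 j)) (M' r j)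
    by_cases hia : i = a
    · exact Or.inl (by rw [← hi, hia])
    by_cases hib : i = b
    · exact Or.inr (Or.inl (by rw [← hi, hib]))
    by_cases hic : i = c
    · exact Or.inr (Or.inr (by rw [← hi, hic]))
    have hir : i = r := hM'.2 j ((houtside i hia hib hic j).trans hi)
    rcases hr with h | h | h <;> simp_all
  have hcand : ∀ j, columnTriple M' a b c j ∈ candidates M fixed a b c j := by
    intro j
    have hdistinct : ∀ r s, r ≠ s → M' r j ≠ M' s j := fun r s hrs h => hrs (hM'.2 j h)
    have hkeep : ∀ r, (!fixed r j || M' r j == M r j) = true := by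
      intro r
      cases hr : fixed r j
      · rfl
      · simp [hfixed r j hr]
    refine List.mem_filter.mpr ⟨mem_rearrangements (hentry a (by simp) j) (hentry b (by simp) j)
      (hentry c (by simp) j) (hdistinct _ _ hab.ne) (hdistinct _ _ (hab.trans hbc).ne)
      (hdistinct _ _ hbc.ne), ?_⟩
    simp only [columnTriple, hkeep, Bool.and_self]
  have hclash : ∀ j k, j ≠ k →
      clash (columnTriple M' a b c j) (columnTriple M' a b c k) = false := by
    intro j k hjk
    have hrow : ∀ r, M' r j ≠ M' r k := fun r h => hjk (hM'.1 r h)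
    simp [clash, columnTriple, hrow]
  have hcols := (forcesOriginal_sound hcand hclash (List.finRange 8) [] true
    (List.nodup_finRange 8) (by simp) (hrigid a b c hab hbc)).2
  funext i j
  have hj := hcols j (List.mem_finRange j)
  simp only [columnTriple, Prod.mk.injEq] at hj
  by_cases hia : i = a
  · exact hia ▸ hj.1
  by_cases hib : i = b
  · exact hib ▸ hj.2.1
  by_cases hic : i = c
  · exact hic ▸ hj.2.2
  exact houtside i hia hib hic j

/-- The conjugate of `W` whose entry in row `e`, column `j` is the row of `W` in which
column `j` contains `e`. -/
def WRowOf : Fin 8 → Fin 8 → Fin 8 :=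
  ![![5, 7, 4, 3, 0, 2, 1, 6],
    ![3, 6, 1, 4, 7, 0, 2, 5],
    ![6, 1, 3, 2, 5, 4, 0, 7],
    ![7, 2, 5, 0, 6, 1, 3, 4],
    ![4, 3, 2, 6, 1, 7, 5, 0],
    ![2, 0, 7, 5, 4, 3, 6, 1],
    ![1, 5, 0, 7, 2, 6, 4, 3],
    ![0, 4, 6, 1, 3, 5, 7, 2]]

theorem W_WRowOf (e j : Fin 8) : W (WRowOf e j) j = e := by
  revert e j; decide +kernel

theorem isLatinSquare_W : IsLatinSquare W := by
  unfold IsLatinSquare Function.Injective; decide +kernel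

theorem isLatinSquare_WRowOf : IsLatinSquare WRowOf := by
  unfold IsLatinSquare Function.Injective; decide +kernel

theorem IsLatinSquare.transpose {n : ℕ} {L : Fin n → Fin n → Fin n} (hL : IsLatinSquare L) :
    IsLatinSquare fun j i => L i j :=
  ⟨hL.2, hL.1⟩

/-- Exchanging the roles of rows and elements in a Latin square gives a Latin square. -/
theorem IsLatinSquare.exists_rowOf {n : ℕ} {L : Fin n → Fin n → Fin n} (hL : IsLatinSquare L) :
    ∃ K : Fin n → Fin n → Fin n, IsLatinSquare K ∧ ∀ e j, L (K e j) j = e := by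
  have hsurj : ∀ e j, ∃ i, L i j = e := fun e j =>
    Finite.injective_iff_surjective.mp (hL.2 j) e
  choose K hK using hsurj
  refine ⟨K, ⟨fun e j k hjk => hL.1 (K e j) ?_, fun j e e' hee => ?_⟩, hK⟩
  · rw [hK e j, hjk, hK e k]
  · rw [← hK e j, ← hK e' j]
    exact congrArg (fun i => L i j) hee

theorem rigid_W : RigidOnThreeRows W fun i j => decide ((i, j, W i j) ∈ W1) := by
  unfold RigidOnThreeRows; decide +kernel

theorem rigid_transpose_W :
    RigidOnThreeRows (fun j i => W i j) fun j i => decide ((i, j, W i j) ∈ W1) := by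
  unfold RigidOnThreeRows; decide +kernel

theorem rigid_WRowOf :
    RigidOnThreeRows WRowOf fun e j => decide ((WRowOf e j, j, e) ∈ W1) := by
  unfold RigidOnThreeRows; decide +kernel

/-- Every Latin trade in `W` with at most three rows, columns, or elements meets `W₁`. -/
theorem small_trades_meet_W1 (T : Finset (Fin 8 × Fin 8 × Fin 8)) (hT : IsTrade W T)
    (h : rowCount T ≤ 3 ∨ colCount T ≤ 3 ∨ elemCount T ≤ 3) :
    (T ∩ W1).Nonempty := by
  obtain ⟨L, hL, hne, hTL⟩ := hT
  by_contra hempty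
  rw [Finset.not_nonempty_iff_eq_empty] at hempty
  have hmem : ∀ i j, W i j ≠ L i j → (i, j, W i j) ∈ T := by
    intro i j hij
    rw [hTL]
    exact Finset.mem_image.mpr ⟨(i, j), by simpa using hij, rfl⟩
  have hkeep : ∀ i j, (i, j, W i j) ∈ W1 → L i j = W i j := by
    intro i j hij
    by_contra hdiff
    have : (i, j, W i j) ∈ T ∩ W1 :=
      Finset.mem_inter.mpr ⟨hmem i j (Ne.symm hdiff), hij⟩
    simp [hempty] at this
  apply hne
  rcases h with h | h | h
  · exact rigid_W.eq isLatinSquare_W hL (fun i j hij => hkeep i j (of_decide_eq_true hij)) h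
      fun i j hij => Finset.mem_image.mpr ⟨_, hmem i j hij, rfl⟩
  · have := rigid_transpose_W.eq isLatinSquare_W.transpose hL.transpose
      (fun j i hij => hkeep i j (of_decide_eq_true hij)) h
      fun j i hij => Finset.mem_image.mpr ⟨_, hmem i j hij, rfl⟩
    funext i j
    exact congrFun (congrFun this j) i
  · obtain ⟨K, hK, hLK⟩ := hL.exists_rowOf
    have hrow : ∀ e j, L (WRowOf e j) j = e → K e j = WRowOf e j := fun e j he =>
      hL.2 j ((hLK e j).trans he.symm)
    have hKW := rigid_WRowOf.eq isLatinSquare_WRowOf hK (by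
        intro e j hej
        apply hrow
        rw [hkeep _ _ (by rw [W_WRowOf]; exact of_decide_eq_true hej), W_WRowOf]) h (by
        intro e j hej
        refine Finset.mem_image.mpr ⟨_, hmem (WRowOf e j) j fun hWL => ?_, W_WRowOf e j⟩
        exact hej (hrow e j (hWL.symm.trans (W_WRowOf e j))).symm)
    funext i j
    have hi : K (L i j) j = i := hL.2 j (hLK (L i j) j)
    rw [hKW] at hi
    rw [← W_WRowOf (L i j) j, hi]
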